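/- arXiv:2605.30616 — 6 statements merged into one kernel-verified Lean document; each statement's English description precedes it below -/
import Mathlib

section
/- Let n ∈ ℕ and let A, B ∈ Matrix (Fin n) (Fin n) ℝ. The block matrix M = Matrix.fromBlocks A B B A ∈ Matrix (Fin (n) ⊕ Fin n) (Fin n ⊕ Fin n) ℝ is positive semidefinite if and only if both A + B and A − B are positive semidefinite (equivalently, −A ≤ B ≤ A in the Loewner order). In particular, if M is positive semidefinite then A and B are symmetric. -/
open Matrix

section Helpers

variable {m : Type*}

theorem isHermitian_fromBlocks_self_swap_iff {A B : Matrix m m ℝ} :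
    (Matrix.fromBlocks A B B A).IsHermitian ↔ A.IsHermitian ∧ B.IsHermitian := by
  rw [Matrix.isHermitian_fromBlocks_iff]
  simp only [Matrix.IsHermitian]
  tauto

variable [Fintype m]

theorem two_mul_dotProduct_fromBlocks_self_swap (A B : Matrix m m ℝ) (u v : m → ℝ) :
    2 * (Sum.elim u v ⬝ᵥ Matrix.fromBlocks A B B A *ᵥ Sum.elim u v) =
      (u + v) ⬝ᵥ (A + B) *ᵥ (u + v) + (u - v) ⬝ᵥ (A - B) *ᵥ (u - v) := by
  simp only [Matrix.fromBlocks_mulVec, Sum.elim_comp_inl, Sum.elim_comp_inr,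
    sumElim_dotProduct_sumElim, Matrix.add_mulVec, Matrix.sub_mulVec, Matrix.mulVec_add,
    Matrix.mulVec_sub, dotProduct_add, dotProduct_sub, add_dotProduct, sub_dotProduct]
  ring

theorem posSemidef_fromBlocks_self_swap_iff {A B : Matrix m m ℝ} :
    (Matrix.fromBlocks A B B A).PosSemidef ↔ (A + B).PosSemidef ∧ (A - B).PosSemidef := by
  constructor
  · intro h
    obtain ⟨hA, hB⟩ := isHermitian_fromBlocks_self_swap_iff.1 h.isHermitian
    refine ⟨.of_dotProduct_mulVec_nonneg (hA.add hB) fun x ↦ ?_,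
      .of_dotProduct_mulVec_nonneg (hA.sub hB) fun x ↦ ?_⟩
    · have key := two_mul_dotProduct_fromBlocks_self_swap A B x x
      have hx := h.dotProduct_mulVec_nonneg (Sum.elim x x)
      simp only [star_trivial, sub_self, zero_dotProduct, ← two_smul ℝ x, smul_dotProduct,
        Matrix.mulVec_smul, dotProduct_smul, smul_eq_mul] at key hx ⊢
      linarith
    · have key := two_mul_dotProduct_fromBlocks_self_swap A B x (-x)
      have hx := h.dotProduct_mulVec_nonneg (Sum.elim x (-x))
      simp only [star_trivial, add_neg_cancel, sub_neg_eq_add, zero_dotProduct, ← two_smul ℝ x,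
        smul_dotProduct, Matrix.mulVec_smul, dotProduct_smul, smul_eq_mul] at key hx ⊢
      linarith
  · rintro ⟨hadd, hsub⟩
    have hA : A.IsHermitian := by
      ext i j
      have h₁ := hadd.isHermitian.apply i j
      have h₂ := hsub.isHermitian.apply i j
      simp only [star_trivial, Matrix.add_apply, Matrix.sub_apply,
        Matrix.conjTranspose_apply] at h₁ h₂ ⊢
      linarith
    have hB : B.IsHermitian := by simpa using hadd.isHermitian.sub hA
    refine .of_dotProduct_mulVec_nonneg (isHermitian_fromBlocks_self_swap_iff.2 ⟨hA, hB⟩)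
      fun x ↦ ?_
    have key := two_mul_dotProduct_fromBlocks_self_swap A B (x ∘ Sum.inl) (x ∘ Sum.inr)
    have h₁ := hadd.dotProduct_mulVec_nonneg (x ∘ Sum.inl + x ∘ Sum.inr)
    have h₂ := hsub.dotProduct_mulVec_nonneg (x ∘ Sum.inl - x ∘ Sum.inr)
    rw [Sum.elim_comp_inl_inr] at key
    simp only [star_trivial] at h₁ h₂ ⊢
    linarith

end Helpers

theorem hyperbolic_block_matrix_posSemidef (n : ℕ) (A B : Matrix (Fin n) (Fin n) ℝ) :
    ((Matrix.fromBlocks A B B A).PosSemidef ↔ (A + B).PosSemidef ∧ (A - B).PosSemidef) ∧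
    ((Matrix.fromBlocks A B B A).PosSemidef → A.IsSymm ∧ B.IsSymm) := by
  refine ⟨posSemidef_fromBlocks_self_swap_iff, fun h ↦ ?_⟩
  obtain ⟨hA, hB⟩ := isHermitian_fromBlocks_self_swap_iff.1 h.isHermitian
  exact ⟨by simpa [Matrix.IsHermitian, Matrix.IsSymm] using hA,
    by simpa [Matrix.IsHermitian, Matrix.IsSymm] using hB⟩
end

section
/- The hyperbolic kernel (1/2)(|p|_ℍ + |q|_ℍ − |p − q|_ℍ) is positive definite on ℍ: for every n ∈ ℕ, every family of points p₁, …, p_n ∈ ℝ × ℝ (writing p_i = (λ_i, μ_i)) and every family of reals c₁, …, c_n, both Σ_{i,j=1}^n c_i c_j (|λ_i| + |λ_j| − |λ_i − λ_j|)/2 ≥ 0 and Σ_{i,j=1}^n c_i c_j (|μ_i| + |μ_j| − |μ_i − μ_j|)/2 ≥ 0. -/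
open MeasureTheory Set

theorem volume_real_uIoc_zero_inter (x y : ℝ) :
    volume.real (uIoc 0 x ∩ uIoc 0 y) = (|x| + |y| - |x - y|) / 2 := by
  rw [uIoc, uIoc, Ioc_inter_Ioc, Real.volume_real_Ioc]
  grind

theorem MeasureTheory.sum_mul_measureReal_inter_nonneg {α ι : Type*} [MeasurableSpace α]
    [Fintype ι] (μ : Measure α) (A : ι → Set α) (hA : ∀ i, MeasurableSet (A i))
    (hA' : ∀ i, μ (A i) ≠ ⊤) (c : ι → ℝ) :
    0 ≤ ∑ i, ∑ j, c i * c j * μ.real (A i ∩ A j) := by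
  have hint (i j : ι) :
      Integrable (fun t ↦ c i * c j * (A i ∩ A j).indicator (1 : α → ℝ) t) μ :=
    ((integrable_indicator_iff ((hA i).inter (hA j))).2
      (integrableOn_const (measure_ne_top_of_subset inter_subset_left (hA' i)))).const_mul _
  calc
    0 ≤ ∫ t, (∑ i, c i * (A i).indicator (1 : α → ℝ) t) ^ 2 ∂μ :=
      integral_nonneg fun t ↦ sq_nonneg _
    _ = ∫ t, ∑ i, ∑ j, c i * c j * (A i ∩ A j).indicator (1 : α → ℝ) t ∂μ := by
      simp only [sq, Finset.sum_mul_sum, inter_indicator_one, Pi.mul_apply, mul_mul_mul_comm]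
    _ = ∑ i, ∑ j, c i * c j * μ.real (A i ∩ A j) := by
      rw [integral_finsetSum _ fun i _ ↦ integrable_finsetSum _ fun j _ ↦ hint i j]
      refine Finset.sum_congr rfl fun i _ ↦ ?_
      rw [integral_finsetSum _ fun j _ ↦ hint i j]
      refine Finset.sum_congr rfl fun j _ ↦ ?_
      rw [integral_const_mul, integral_indicator_one ((hA i).inter (hA j))]

theorem sum_mul_abs_add_abs_sub_abs_sub_nonneg {ι : Type*} [Fintype ι] (x c : ι → ℝ) :
    0 ≤ ∑ i, ∑ j, c i * c j * ((|x i| + |x j| - |x i - x j|) / 2) := by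
  simp only [← volume_real_uIoc_zero_inter]
  exact sum_mul_measureReal_inter_nonneg volume (fun i ↦ uIoc 0 (x i))
    (fun _ ↦ measurableSet_uIoc) (fun _ ↦ measure_Ioc_lt_top.ne) c

theorem hyperbolic_bm_kernel_posDef (n : ℕ) (p : Fin n → ℝ × ℝ) (c : Fin n → ℝ) :
    0 ≤ ∑ i, ∑ j, c i * c j * ((|(p i).1| + |(p j).1| - |(p i).1 - (p j).1|) / 2) ∧
    0 ≤ ∑ i, ∑ j, c i * c j * ((|(p i).2| + |(p j).2| - |(p i).2 - (p j).2|) / 2) :=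
  ⟨sum_mul_abs_add_abs_sub_abs_sub_nonneg (fun i ↦ (p i).1) c,
    sum_mul_abs_add_abs_sub_abs_sub_nonneg (fun i ↦ (p i).2) c⟩
end

section
/- For H ∈ (0, 1), the integral V_H = ∫_0^∞ (1 − cos u)·u^{1−2H}/u² du converges, and V_H = Γ(2 − 2H)·cos(Hπ)/((1 − 2H)·2H) when H ≠ 1/2, while V_{1/2} = ∫_0^∞ (1 − cos u)/u² du = π/2. -/
open MeasureTheory Real

theorem lintegral_ofReal_eq_of_integral_eq {f : ℝ → ℝ} {c : ℝ} (hc : 0 < c)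
    (hf : ∀ x, 0 < x → 0 ≤ f x) (h : ∫ x in Set.Ioi (0 : ℝ), f x = c) :
    ∫⁻ x in Set.Ioi (0 : ℝ), ENNReal.ofReal (f x) = ENNReal.ofReal c := by
  have hint : IntegrableOn f (Set.Ioi 0) := .of_integral_ne_zero (by rw [h]; exact hc.ne')
  rw [← ofReal_integral_eq_lintegral_ofReal hint, h]
  filter_upwards [ae_restrict_mem measurableSet_Ioi] with x hx using hf x hx

theorem integrableOn_and_integral_eq_of_lintegral_eq {f : ℝ → ℝ} {c : ℝ} (hm : Measurable f)
    (hc : 0 ≤ c) (hf : ∀ x, 0 < x → 0 ≤ f x)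
    (h : ∫⁻ x in Set.Ioi (0 : ℝ), ENNReal.ofReal (f x) = ENNReal.ofReal c) :
    IntegrableOn f (Set.Ioi 0) ∧ ∫ x in Set.Ioi (0 : ℝ), f x = c := by
  have hnn : 0 ≤ᵐ[volume.restrict (Set.Ioi (0 : ℝ))] f := by
    filter_upwards [ae_restrict_mem measurableSet_Ioi] with x hx using hf x hx
  refine ⟨(lintegral_ofReal_ne_top_iff_integrable hm.aestronglyMeasurable hnn).1
    (h ▸ ENNReal.ofReal_ne_top), ?_⟩
  rw [integral_eq_lintegral_of_nonneg_ae hnn hm.aestronglyMeasurable, h, ENNReal.toReal_ofReal hc]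

/-- Tonelli's theorem on the positive quadrant, in terms of the two marginals. -/
theorem lintegral_Ioi_marginals_eq {k : ℝ → ℝ → ℝ} {g h : ℝ → ℝ}
    (hk : Measurable (Function.uncurry k))
    (hg : ∀ x, 0 < x → ∫⁻ y in Set.Ioi (0 : ℝ), ENNReal.ofReal (k x y) = ENNReal.ofReal (g x))
    (hh : ∀ y, 0 < y → ∫⁻ x in Set.Ioi (0 : ℝ), ENNReal.ofReal (k x y) = ENNReal.ofReal (h y)) :
    ∫⁻ x in Set.Ioi (0 : ℝ), ENNReal.ofReal (g x) =
      ∫⁻ y in Set.Ioi (0 : ℝ), ENNReal.ofReal (h y) := by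
  rw [← setLIntegral_congr_fun measurableSet_Ioi fun x hx => hg x hx,
    ← setLIntegral_congr_fun measurableSet_Ioi fun y hy => hh y hy]
  exact lintegral_lintegral_swap hk.ennreal_ofReal.aemeasurable

/-- The Laplace transform of `1 - cos`. -/
theorem integral_one_sub_cos_mul_exp {t : ℝ} (ht : 0 < t) :
    ∫ u in Set.Ioi (0 : ℝ), (1 - cos u) * exp (-(t * u)) = 1 / (t * (1 + t ^ 2)) := by
  have hd (u : ℝ) : HasDerivAt
      (fun u => exp (-(t * u)) * (-1 / t - (sin u - t * cos u) / (1 + t ^ 2)))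
      ((1 - cos u) * exp (-(t * u))) u := by
    have he : HasDerivAt (fun u => exp (-(t * u))) (exp (-(t * u)) * (-(t * 1))) u :=
      ((hasDerivAt_id u).const_mul t).neg.exp
    have hs := (((hasDerivAt_sin u).sub ((hasDerivAt_cos u).const_mul t)).div_const
      (1 + t ^ 2)).const_sub (-1 / t)
    refine (he.mul hs).congr_deriv ?_
    have : 1 + t ^ 2 ≠ 0 := by positivity
    simp only [Pi.sub_apply]
    field_simp
    ring
  have hlim : Filter.Tendsto
      (fun u => exp (-(t * u)) * (-1 / t - (sin u - t * cos u) / (1 + t ^ 2)))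
      Filter.atTop (nhds 0) := by
    have he : Filter.Tendsto (fun u => exp (-(t * u))) Filter.atTop (nhds 0) :=
      tendsto_exp_neg_atTop_nhds_zero.comp (Filter.tendsto_id.const_mul_atTop ht)
    refine he.zero_mul_isBoundedUnder_le ?_
    refine Filter.isBoundedUnder_of ⟨1 / t + (1 + t) / (1 + t ^ 2), fun u => ?_⟩
    have h1 : |sin u - t * cos u| ≤ 1 + t := by
      refine (abs_sub _ _).trans (add_le_add (abs_sin_le_one u) ?_)
      rw [abs_mul, abs_of_pos ht]
      exact mul_le_of_le_one_right ht.le (abs_cos_le_one u)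
    refine (norm_sub_le _ _).trans (add_le_add ?_ ?_)
    · rw [Real.norm_eq_abs, abs_div, abs_neg, abs_one, abs_of_pos ht]
    · rw [Real.norm_eq_abs, abs_div, abs_of_pos (show 0 < 1 + t ^ 2 by positivity)]
      gcongr
  rw [integral_Ioi_of_hasDerivAt_of_nonneg' (fun u _ => hd u)
    (fun u _ => mul_nonneg (sub_nonneg.2 (cos_le_one u)) (exp_nonneg _)) hlim]
  simp only [mul_zero, neg_zero, exp_zero, sin_zero, cos_zero]
  field_simp
  ring

theorem lintegral_rpow_div_one_add_sq {s : ℝ} (hs0 : 0 < s) (hs2 : s < 2) :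
    ∫⁻ t in Set.Ioi (0 : ℝ), ENNReal.ofReal (t ^ (s - 1) / (1 + t ^ 2)) =
      ENNReal.ofReal (π / (2 * sin (π * (s / 2)))) := by
  have hG : 0 < Gamma (s / 2) := Gamma_pos_of_pos (by linarith)
  have hG' : 0 < Gamma (1 - s / 2) := Gamma_pos_of_pos (by linarith)
  have hval : π / (2 * sin (π * (s / 2))) = (1 / 2) * Gamma (s / 2) * Gamma (1 - s / 2) := by
    rw [mul_assoc, Gamma_mul_Gamma_one_sub, mul_comm 2, ← div_div]
    ring
  rw [lintegral_Ioi_marginals_eq (k := fun t x => t ^ (s - 1) * exp (-((1 + t ^ 2) * x)))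
    (h := fun x => x ^ (-(s / 2)) * exp (-x) * ((1 / 2) * Gamma (s / 2)))]
  · refine lintegral_ofReal_eq_of_integral_eq (by rw [hval]; positivity)
      (fun x hx => by positivity) ?_
    rw [integral_mul_const, hval, Gamma_eq_integral (show 0 < 1 - s / 2 by linarith), mul_comm]
    congr 1
    refine setIntegral_congr_fun measurableSet_Ioi fun x _ => ?_
    rw [mul_comm, show 1 - s / 2 - 1 = -(s / 2) by ring]
  · unfold Function.uncurry
    fun_prop
  · intro t ht
    refine lintegral_ofReal_eq_of_integral_eq (by positivity) (fun x hx => by positivity) ?_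
    have := integral_exp_mul_Ioi (a := -(1 + t ^ 2)) (by nlinarith) 0
    rw [integral_const_mul]
    simp only [neg_mul] at this
    rw [this, neg_div_neg_eq, mul_zero, neg_zero, exp_zero, mul_one_div]
  · intro x hx
    refine lintegral_ofReal_eq_of_integral_eq (by positivity) (fun t ht => by positivity) ?_
    have := integral_rpow_mul_exp_neg_mul_rpow (p := 2) (q := s - 1) two_pos (by linarith) hx
    rw [show -(s - 1 + 1) / 2 = -(s / 2) by ring, show (s - 1 + 1) / 2 = s / 2 by ring] at this
    rw [show x ^ (-(s / 2)) * exp (-x) * (1 / 2 * Gamma (s / 2)) =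
      exp (-x) * (x ^ (-(s / 2)) * (1 / 2) * Gamma (s / 2)) by ring, ← this, ← integral_const_mul]
    refine setIntegral_congr_fun measurableSet_Ioi fun t _ => ?_
    simp only [rpow_two]
    rw [mul_left_comm, ← exp_add]
    ring_nf

theorem integrableOn_and_integral_one_sub_cos_mul_rpow {s : ℝ} (hs0 : 0 < s) (hs2 : s < 2) :
    IntegrableOn (fun u : ℝ => (1 - cos u) * u ^ (-(s + 1))) (Set.Ioi 0) ∧
    ∫ u in Set.Ioi (0 : ℝ), (1 - cos u) * u ^ (-(s + 1)) =
      π / (2 * sin (π * (s / 2))) / Gamma (s + 1) := by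
  have hG : 0 < Gamma (s + 1) := Gamma_pos_of_pos (by linarith)
  have hsin : 0 < sin (π * (s / 2)) :=
    sin_pos_of_pos_of_lt_pi (by positivity) (by nlinarith [pi_pos])
  have hcos (u : ℝ) : 0 ≤ 1 - cos u := sub_nonneg.2 (cos_le_one u)
  refine integrableOn_and_integral_eq_of_lintegral_eq (by fun_prop) (by positivity)
    (fun u hu => mul_nonneg (hcos u) (by positivity)) ?_
  rw [lintegral_Ioi_marginals_eq
    (k := fun u t => (1 - cos u) / Gamma (s + 1) * (t ^ s * exp (-(u * t))))
    (h := fun t => 1 / Gamma (s + 1) * (t ^ (s - 1) / (1 + t ^ 2)))]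
  · simp_rw [ENNReal.ofReal_mul (show 0 ≤ 1 / Gamma (s + 1) by positivity)]
    rw [lintegral_const_mul' _ _ ENNReal.ofReal_ne_top, lintegral_rpow_div_one_add_sq hs0 hs2,
      ← ENNReal.ofReal_mul (by positivity)]
    congr 1
    ring
  · unfold Function.uncurry
    fun_prop
  · intro u hu
    rcases (hcos u).eq_or_lt with h0 | hpos
    · simp [← h0]
    refine lintegral_ofReal_eq_of_integral_eq (by positivity) (fun t ht => by positivity) ?_
    have := integral_rpow_mul_exp_neg_mul_Ioi (show 0 < s + 1 by linarith) hu
    rw [add_sub_cancel_right] at this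
    rw [integral_const_mul, this, rpow_neg hu.le, one_div, inv_rpow hu.le]
    field_simp
  · intro t ht
    refine lintegral_ofReal_eq_of_integral_eq (by positivity)
      (fun u hu => mul_nonneg (div_nonneg (hcos u) hG.le) (by positivity)) ?_
    have h : (fun u => (1 - cos u) / Gamma (s + 1) * (t ^ s * exp (-(u * t)))) =
        fun u => t ^ s / Gamma (s + 1) * ((1 - cos u) * exp (-(t * u))) := by
      ext u
      rw [mul_comm u t]
      ring
    rw [h, integral_const_mul, integral_one_sub_cos_mul_exp ht, rpow_sub_one ht.ne']
    field_simp

theorem VH_integral (H : ℝ) (hH : H ∈ Set.Ioo (0 : ℝ) 1) :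
    IntegrableOn (fun u : ℝ => (1 - Real.cos u) * u ^ (1 - 2 * H) / u ^ 2) (Set.Ioi 0) ∧
    (H ≠ 1 / 2 →
      ∫ u in Set.Ioi (0 : ℝ), (1 - Real.cos u) * u ^ (1 - 2 * H) / u ^ 2 =
        Real.Gamma (2 - 2 * H) * Real.cos (H * Real.pi) / ((1 - 2 * H) * (2 * H))) ∧
    (H = 1 / 2 →
      ∫ u in Set.Ioi (0 : ℝ), (1 - Real.cos u) * u ^ (1 - 2 * H) / u ^ 2 = Real.pi / 2) := by
  obtain ⟨h0, h1⟩ := hH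
  have hcongr : Set.EqOn (fun u : ℝ => (1 - cos u) * u ^ (-(2 * H + 1)))
      (fun u : ℝ => (1 - cos u) * u ^ (1 - 2 * H) / u ^ 2) (Set.Ioi 0) := fun u hu => by
    simp only
    rw [mul_div_assoc, ← rpow_two, ← rpow_sub hu]
    ring_nf
  obtain ⟨hint, hval⟩ := integrableOn_and_integral_one_sub_cos_mul_rpow (s := 2 * H)
    (by linarith) (by linarith)
  rw [← setIntegral_congr_fun measurableSet_Ioi hcongr, hval, mul_div_cancel_left₀ H two_ne_zero]
  refine ⟨hint.congr_fun hcongr measurableSet_Ioi, fun hne => ?_, fun heq => ?_⟩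
  · have hsub : 1 - 2 * H ≠ 0 := fun h => hne (by linarith)
    have hsin : 0 < sin (π * H) :=
      sin_pos_of_pos_of_lt_pi (by positivity) (by nlinarith [pi_pos])
    have hcos : cos (π * H) ≠ 0 := by
      rcases hne.lt_or_gt with h | h
      · exact (cos_pos_of_mem_Ioo ⟨by nlinarith [pi_pos], by nlinarith [pi_pos]⟩).ne'
      · exact (cos_neg_of_pi_div_two_lt_of_lt (by nlinarith [pi_pos])
          (by nlinarith [pi_pos])).ne
    have hG : 0 < Gamma (2 * H) := Gamma_pos_of_pos (by linarith)
    have hrefl := Gamma_mul_Gamma_one_sub (2 * H)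
    rw [show π * (2 * H) = 2 * (π * H) by ring, sin_two_mul,
      eq_div_iff (by positivity)] at hrefl
    rw [Gamma_add_one (by positivity), show 2 - 2 * H = 1 - 2 * H + 1 by ring,
      Gamma_add_one hsub, mul_comm H π]
    generalize sin (π * H) = a at *
    generalize cos (π * H) = b at *
    rw [← hrefl]
    field_simp
  · subst heq
    norm_num [← mul_div_assoc]
end

section
/- Let H ∈ (0, 1). For all t, s ∈ ℝ, the function u ↦ ((1 − cos(tu))(1 − cos(su)) + sin(tu)·sin(su))·|u|^{1−2H}/u² is integrable on ℝ and (1/(2π))·∫_ℝ ((1 − cos(tu))(1 − cos(su)) + sin(tu)·sin(su))·|u|^{1−2H}/u² du = (V_H/π)·(|t|^{2H} + |s|^{2H} − |t − s|^{2H}). -/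
open MeasureTheory Real

lemma integrable_comp_abs_of_integrableOn_Ioi {f : ℝ → ℝ} (hf : IntegrableOn f (Set.Ioi 0)) :
    Integrable (fun x => f |x|) := by
  have hpos : IntegrableOn (fun x => f |x|) (Set.Ioi 0) :=
    hf.congr_fun (fun x hx => by simp only [abs_of_pos (Set.mem_Ioi.1 hx)]) measurableSet_Ioi
  have hneg : IntegrableOn (fun x => f |x|) (Set.Iic 0) := by
    rw [integrableOn_Iic_iff_integrableOn_Iio, ← neg_zero,
      ← (Measure.measurePreserving_neg (volume : Measure ℝ)).integrableOn_comp_preimage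
        (Homeomorph.neg ℝ).measurableEmbedding]
    simpa [Function.comp_def] using hpos
  rw [← integrableOn_univ, ← Set.Iic_union_Ioi (a := (0 : ℝ))]
  exact hneg.union hpos

lemma integrableOn_one_sub_cos_mul_rpow {H : ℝ} (hH : H ∈ Set.Ioo (0 : ℝ) 1) :
    IntegrableOn (fun u : ℝ => (1 - Real.cos u) * u ^ (1 - 2 * H) / u ^ 2) (Set.Ioi 0) := by
  obtain ⟨h0, h1⟩ := hH
  have hm : Measurable (fun u : ℝ => (1 - Real.cos u) * u ^ (1 - 2 * H) / u ^ 2) := by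
    fun_prop
  rw [← Set.Ioc_union_Ioi_eq_Ioi zero_le_one]
  refine IntegrableOn.union ?_ ?_
  · have hi : IntegrableOn (fun u : ℝ => u ^ (1 - 2 * H)) (Set.Ioc 0 1) :=
      (intervalIntegrable_iff_integrableOn_Ioc_of_le zero_le_one).1
        (intervalIntegral.intervalIntegrable_rpow' (by linarith))
    refine Integrable.mono' hi hm.aestronglyMeasurable ?_
    refine (ae_restrict_iff' measurableSet_Ioc).2 (.of_forall fun u hu => ?_)
    have hu0 : 0 < u := hu.1
    have hp : 0 < u ^ (1 - 2 * H) := Real.rpow_pos_of_pos hu0 _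
    have hc := Real.one_sub_sq_div_two_le_cos (x := u)
    have hc' := Real.cos_le_one u
    rw [Real.norm_of_nonneg (by have := sub_nonneg.2 hc'; positivity),
      div_le_iff₀ (by positivity), mul_comm]
    exact mul_le_mul_of_nonneg_left (by nlinarith) hp.le
  · have hi : IntegrableOn (fun u : ℝ => 2 * u ^ (-1 - 2 * H)) (Set.Ioi 1) :=
      (integrableOn_Ioi_rpow_of_lt (by linarith) zero_lt_one).const_mul 2
    refine Integrable.mono' hi hm.aestronglyMeasurable ?_
    refine (ae_restrict_iff' measurableSet_Ioi).2 (.of_forall fun u hu => ?_)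
    have hu0 : 0 < u := zero_lt_one.trans hu
    have hc := Real.neg_one_le_cos u
    have hc' := Real.cos_le_one u
    have hp : u ^ (1 - 2 * H) = u ^ (-1 - 2 * H) * u ^ 2 := by
      rw [← Real.rpow_natCast u 2, ← Real.rpow_add hu0]
      norm_num
      ring_nf
    have hq : 0 < u ^ (-1 - 2 * H) := Real.rpow_pos_of_pos hu0 _
    rw [Real.norm_of_nonneg (by have := sub_nonneg.2 hc'; positivity), hp, ← mul_assoc,
      mul_div_cancel_right₀ _ (by positivity)]
    exact mul_le_mul_of_nonneg_right (by linarith) hq.le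

lemma one_sub_cos_mul_rpow_abs_scale (H : ℝ) {c : ℝ} (hc : c ≠ 0) (u : ℝ) :
    (1 - Real.cos (c * u)) * |u| ^ (1 - 2 * H) / u ^ 2 =
      |c| ^ (2 * H + 1) *
        ((1 - Real.cos |c * u|) * |c * u| ^ (1 - 2 * H) / |c * u| ^ 2) := by
  rcases eq_or_ne u 0 with rfl | hu
  · simp
  have hc' : 0 < |c| := abs_pos.2 hc
  have key : |c| ^ (2 * H + 1) * |c| ^ (1 - 2 * H) = c ^ 2 := by
    rw [← Real.rpow_add hc', ← sq_abs c, ← Real.rpow_natCast]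
    congr 1
    push_cast
    ring
  rw [Real.cos_abs, sq_abs, abs_mul, Real.mul_rpow (abs_nonneg _) (abs_nonneg _), mul_pow,
    mul_div_assoc', div_eq_div_iff (by positivity) (by positivity), ← key]
  ring

lemma integrable_one_sub_cos_mul_rpow_abs {H : ℝ} (hH : H ∈ Set.Ioo (0 : ℝ) 1) (c : ℝ) :
    Integrable (fun u : ℝ => (1 - Real.cos (c * u)) * |u| ^ (1 - 2 * H) / u ^ 2) := by
  rcases eq_or_ne c 0 with rfl | hc
  · simp
  simp_rw [one_sub_cos_mul_rpow_abs_scale H hc]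
  refine Integrable.const_mul (Integrable.comp_mul_left'
    (g := fun u => (1 - Real.cos |u|) * |u| ^ (1 - 2 * H) / |u| ^ 2) ?_ hc) _
  exact integrable_comp_abs_of_integrableOn_Ioi (integrableOn_one_sub_cos_mul_rpow hH)

lemma integral_one_sub_cos_mul_rpow_abs {H : ℝ} (hH : 0 < H) (c : ℝ) :
    ∫ u : ℝ, (1 - Real.cos (c * u)) * |u| ^ (1 - 2 * H) / u ^ 2 =
      2 * |c| ^ (2 * H) *
        ∫ u in Set.Ioi (0 : ℝ), (1 - Real.cos u) * u ^ (1 - 2 * H) / u ^ 2 := by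
  rcases eq_or_ne c 0 with rfl | hc
  · simp [Real.zero_rpow (mul_pos two_pos hH).ne']
  have hc' : 0 < |c| := abs_pos.2 hc
  simp_rw [one_sub_cos_mul_rpow_abs_scale H hc]
  rw [integral_const_mul, Measure.integral_comp_mul_left
    (fun u => (1 - Real.cos |u|) * |u| ^ (1 - 2 * H) / |u| ^ 2) c,
    integral_comp_abs (f := fun u => (1 - Real.cos u) * u ^ (1 - 2 * H) / u ^ 2),
    Real.rpow_add hc', Real.rpow_one, abs_inv, smul_eq_mul]
  field_simp

theorem fbm_spectral_covariance (H : ℝ) (hH : H ∈ Set.Ioo (0 : ℝ) 1) (t s : ℝ) :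
    Integrable (fun u : ℝ =>
      ((1 - Real.cos (t * u)) * (1 - Real.cos (s * u)) + Real.sin (t * u) * Real.sin (s * u))
        * |u| ^ (1 - 2 * H) / u ^ 2) ∧
    (1 / (2 * Real.pi)) * ∫ u : ℝ,
        ((1 - Real.cos (t * u)) * (1 - Real.cos (s * u)) + Real.sin (t * u) * Real.sin (s * u))
          * |u| ^ (1 - 2 * H) / u ^ 2
      = ((∫ u in Set.Ioi (0 : ℝ), (1 - Real.cos u) * u ^ (1 - 2 * H) / u ^ 2) / Real.pi)
          * (|t| ^ (2 * H) + |s| ^ (2 * H) - |t - s| ^ (2 * H)) := by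
  have hsplit (u : ℝ) :
      ((1 - Real.cos (t * u)) * (1 - Real.cos (s * u)) + Real.sin (t * u) * Real.sin (s * u))
          * |u| ^ (1 - 2 * H) / u ^ 2 =
        (1 - Real.cos (t * u)) * |u| ^ (1 - 2 * H) / u ^ 2
          + (1 - Real.cos (s * u)) * |u| ^ (1 - 2 * H) / u ^ 2
          - (1 - Real.cos ((t - s) * u)) * |u| ^ (1 - 2 * H) / u ^ 2 := by
    rw [sub_mul t s u, Real.cos_sub]
    ring
  have hint := integrable_one_sub_cos_mul_rpow_abs hH
  simp_rw [hsplit]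
  refine ⟨((hint t).add (hint s)).sub (hint (t - s)), ?_⟩
  rw [integral_sub (by exact (hint t).add (hint s)) (hint (t - s)), integral_add (hint t) (hint s)]
  simp_rw [integral_one_sub_cos_mul_rpow_abs hH.1]
  field_simp
end

section
/- For every H ∈ (0, 1), the kernel K_H(t, s) = |t|^{2H} + |s|^{2H} − |t − s|^{2H} is positive definite on ℝ: for all n ∈ ℕ, all t₁, …, t_n ∈ ℝ and all c₁, …, c_n ∈ ℝ, Σ_{i,j=1}^n c_i c_j (|t_i|^{2H} + |t_j|^{2H} − |t_i − t_j|^{2H}) ≥ 0. -/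
open MeasureTheory Set

/-- The weighted function `(1 - cos (a * u)) * u ^ p` whose integral over `(0, ∞)` is proportional
to `|a| ^ (-1 - p)`. -/
noncomputable def oneSubCosWeight (p a u : ℝ) : ℝ := (1 - Real.cos (a * u)) * u ^ p

theorem oneSubCosWeight_one_nonneg (p : ℝ) {u : ℝ} (hu : 0 < u) : 0 ≤ oneSubCosWeight p 1 u :=
  mul_nonneg (by linarith [Real.cos_le_one (1 * u)]) (Real.rpow_nonneg hu.le _)

theorem integrableOn_oneSubCosWeight_one {p : ℝ} (h₁ : -3 < p) (h₂ : p < -1) :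
    IntegrableOn (oneSubCosWeight p 1) (Ioi 0) := by
  have hmeas : Measurable (oneSubCosWeight p 1) := by unfold oneSubCosWeight; fun_prop
  rw [← Ioc_union_Ioi_eq_Ioi zero_le_one, integrableOn_union]
  constructor
  · have hint : IntegrableOn (fun u : ℝ => u ^ (p + 2)) (Ioc 0 1) :=
      (intervalIntegrable_iff_integrableOn_Ioc_of_le zero_le_one).1
        (intervalIntegral.intervalIntegrable_rpow' (by linarith))
    refine Integrable.mono' hint hmeas.aestronglyMeasurable ?_
    filter_upwards [ae_restrict_mem measurableSet_Ioc] with u hu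
    rw [Real.norm_of_nonneg (oneSubCosWeight_one_nonneg p hu.1), Real.rpow_add hu.1, mul_comm,
      oneSubCosWeight, Real.rpow_two]
    gcongr
    · exact Real.rpow_nonneg hu.1.le _
    · rw [one_mul]
      nlinarith [Real.one_sub_sq_div_two_le_cos (x := u), sq_nonneg u]
  · refine Integrable.mono' ((integrableOn_Ioi_rpow_of_lt h₂ one_pos).const_mul 2)
      hmeas.aestronglyMeasurable ?_
    filter_upwards [ae_restrict_mem measurableSet_Ioi] with u hu
    have hu0 : 0 < u := one_pos.trans hu
    rw [Real.norm_of_nonneg (oneSubCosWeight_one_nonneg p hu0), oneSubCosWeight]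
    gcongr
    linarith [Real.neg_one_le_cos (1 * u)]

theorem integral_oneSubCosWeight_one_pos {p : ℝ} (h₁ : -3 < p) (h₂ : p < -1) :
    0 < ∫ u in Ioi 0, oneSubCosWeight p 1 u := by
  rw [setIntegral_pos_iff_support_of_nonneg_ae _ (integrableOn_oneSubCosWeight_one h₁ h₂)]
  · refine lt_of_lt_of_le ?_ (measure_mono (s := Ioo (0 : ℝ) 1) ?_)
    · simp
    · rintro u ⟨hu0, hu1⟩
      refine ⟨(mul_pos ?_ (Real.rpow_pos_of_pos hu0 _)).ne', hu0⟩
      have := Real.cos_lt_cos_of_nonneg_of_le_pi le_rfl (by linarith [Real.pi_gt_three]) hu0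
      rw [Real.cos_zero] at this
      rw [one_mul]
      linarith
  · filter_upwards [ae_restrict_mem measurableSet_Ioi] with u hu
    exact oneSubCosWeight_one_nonneg p hu

theorem oneSubCosWeight_eq_scale (p : ℝ) {a u : ℝ} (ha : a ≠ 0) (hu : 0 < u) :
    oneSubCosWeight p a u = |a| ^ (-p) * oneSubCosWeight p 1 (|a| * u) := by
  have ha' : 0 < |a| := abs_pos.2 ha
  have hcos : Real.cos (|a| * u) = Real.cos (a * u) := by
    rw [← Real.cos_abs (a * u), abs_mul, abs_of_pos hu]
  have hinv : |a| ^ (-p) * |a| ^ p = 1 := by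
    rw [← Real.rpow_add ha', neg_add_cancel, Real.rpow_zero]
  rw [oneSubCosWeight, oneSubCosWeight, one_mul, hcos, Real.mul_rpow ha'.le hu.le]
  linear_combination (-(1 - Real.cos (a * u)) * u ^ p) * hinv

theorem integrableOn_oneSubCosWeight {p : ℝ} (h₁ : -3 < p) (h₂ : p < -1) (a : ℝ) :
    IntegrableOn (oneSubCosWeight p a) (Ioi 0) := by
  rcases eq_or_ne a 0 with rfl | ha
  · have hzero : oneSubCosWeight p 0 = 0 := by ext u; simp [oneSubCosWeight]
    rw [hzero]
    exact integrableOn_zero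
  · refine IntegrableOn.congr_fun (f := fun u => |a| ^ (-p) * oneSubCosWeight p 1 (|a| * u)) ?_
      (fun u hu => (oneSubCosWeight_eq_scale p ha hu).symm) measurableSet_Ioi
    refine Integrable.const_mul ?_ _
    refine (integrableOn_Ioi_comp_mul_left_iff _ 0 (abs_pos.2 ha)).2 ?_
    rw [mul_zero]
    exact integrableOn_oneSubCosWeight_one h₁ h₂

theorem integral_oneSubCosWeight {p : ℝ} (h : p < -1) (a : ℝ) :
    ∫ u in Ioi 0, oneSubCosWeight p a u =
      |a| ^ (-1 - p) * ∫ u in Ioi 0, oneSubCosWeight p 1 u := by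
  rcases eq_or_ne a 0 with rfl | ha
  · have hp : -1 - p ≠ 0 := by linarith
    simp [oneSubCosWeight, Real.zero_rpow hp]
  · have ha' : 0 < |a| := abs_pos.2 ha
    rw [setIntegral_congr_fun measurableSet_Ioi fun u hu => oneSubCosWeight_eq_scale p ha hu,
      integral_const_mul, integral_comp_mul_left_Ioi _ _ ha', mul_zero, smul_eq_mul, ← mul_assoc,
      ← Real.rpow_neg_one |a|, ← Real.rpow_add ha']
    ring_nf

theorem sum_oneSubCosWeight_eq (p u : ℝ) {ι : Type*} [Fintype ι] (t c : ι → ℝ) :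
    ∑ i, ∑ j, c i * c j * (oneSubCosWeight p (t i) u + oneSubCosWeight p (t j) u
      - oneSubCosWeight p (t i - t j) u) =
    ((∑ i, c i * (1 - Real.cos (t i * u))) ^ 2 + (∑ i, c i * Real.sin (t i * u)) ^ 2) * u ^ p := by
  rw [sq, sq, Finset.sum_mul_sum, Finset.sum_mul_sum, ← Finset.sum_add_distrib]
  simp only [← Finset.sum_add_distrib, Finset.sum_mul]
  refine Finset.sum_congr rfl fun i _ => Finset.sum_congr rfl fun j _ => ?_
  simp only [oneSubCosWeight, sub_mul, Real.cos_sub]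
  ring

theorem fbm_kernel_posDef (H : ℝ) (hH : H ∈ Set.Ioo (0 : ℝ) 1)
    (n : ℕ) (t : Fin n → ℝ) (c : Fin n → ℝ) :
    0 ≤ ∑ i, ∑ j, c i * c j * (|t i| ^ (2 * H) + |t j| ^ (2 * H) - |t i - t j| ^ (2 * H)) := by
  obtain ⟨p, hp⟩ : ∃ p, p = -1 - 2 * H := ⟨_, rfl⟩
  have h₁ : -3 < p := by linarith [hH.2]
  have h₂ : p < -1 := by linarith [hH.1]
  have hexp : 2 * H = -1 - p := by linarith
  have hint := integrableOn_oneSubCosWeight h₁ h₂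
  refine nonneg_of_mul_nonneg_left ?_ (integral_oneSubCosWeight_one_pos h₁ h₂)
  calc 0 ≤ ∫ u in Ioi 0, ∑ i, ∑ j, c i * c j * (oneSubCosWeight p (t i) u
        + oneSubCosWeight p (t j) u - oneSubCosWeight p (t i - t j) u) := by
        refine setIntegral_nonneg measurableSet_Ioi fun u hu => ?_
        rw [sum_oneSubCosWeight_eq]
        exact mul_nonneg (by positivity) (Real.rpow_nonneg (le_of_lt hu) _)
    _ = _ := by
        have hterm (i j : Fin n) : IntegrableOn (fun u => c i * c j * (oneSubCosWeight p (t i) u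
            + oneSubCosWeight p (t j) u - oneSubCosWeight p (t i - t j) u)) (Ioi 0) :=
          (((hint _).add (hint _)).sub (hint _)).const_mul _
        rw [integral_finsetSum _ fun i _ => integrable_finsetSum _ fun j _ => hterm i j,
          Finset.sum_mul]
        refine Finset.sum_congr rfl fun i _ => ?_
        rw [integral_finsetSum _ fun j _ => hterm i j, Finset.sum_mul]
        refine Finset.sum_congr rfl fun j _ => ?_
        rw [integral_const_mul, integral_sub (by exact (hint _).add (hint _)) (hint _),
          integral_add (hint _) (hint _), integral_oneSubCosWeight h₂ (t i),
          integral_oneSubCosWeight h₂ (t j), integral_oneSubCosWeight h₂ (t i - t j), hexp]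
        ring
end

section
/- Let ζ_n (n ∈ ℕ₀) denote the normalized (physicists') Hermite functions, and suppose C > 0 is such that |ζ_n(x)| ≤ C for all n ∈ ℕ₀ and x ∈ ℝ. Fix λ ∈ ℝ. Then lim_{h → 0, h ≠ 0} Σ_{n=0}^∞ (1/(8(n+1)³))·((1/h)·∫_λ^{λ+h} ζ_n(u) du − ζ_n(λ))² = 0; moreover for 0 < |h| ≤ 1 one has the bound Σ_{n=0}^∞ (1/(8(n+1)³))·((1/h)·∫_λ^{λ+h} ζ_n(u) du − ζ_n(λ))² ≤ h²·Σ_{n=0}^∞ (1/(8(n+1)³))·C²·(|λ| + 1 + √(2(n+1)))², and the series on the right converges. -/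
/-- The normalized (physicists') Hermite functions. -/
noncomputable def normalizedHermiteFun (n : ℕ) (x : ℝ) : ℝ :=
  ((-1 : ℝ) ^ n / (Real.pi ^ ((1 : ℝ) / 4) * 2 ^ ((n : ℝ) / 2) * Real.sqrt (Nat.factorial n))) *
    Real.exp (x ^ 2 / 2) * iteratedDeriv n (fun y : ℝ => Real.exp (-(y ^ 2))) x

open Real in
theorem hasDerivAt_normalizedHermiteFun (n : ℕ) (x : ℝ) :
    HasDerivAt (normalizedHermiteFun n)
      (x * normalizedHermiteFun n x - √(2 * ((n : ℝ) + 1)) * normalizedHermiteFun (n + 1) x) x := by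
  have hsmooth : ContDiff ℝ (n + 1 : ℕ) (fun y : ℝ => exp (-(y ^ 2))) := by fun_prop
  have hiter : HasDerivAt (iteratedDeriv n (fun y : ℝ => exp (-(y ^ 2))))
      (iteratedDeriv (n + 1) (fun y : ℝ => exp (-(y ^ 2))) x) x := by
    rw [iteratedDeriv_succ]
    exact (hsmooth.differentiable_iteratedDeriv n (by exact_mod_cast n.lt_succ_self) x).hasDerivAt
  have hexp : HasDerivAt (fun y : ℝ => exp (y ^ 2 / 2)) (exp (x ^ 2 / 2) * x) x := by
    convert ((hasDerivAt_pow 2 x).div_const 2).exp using 1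
    norm_num
  have h := (hexp.const_mul ((-1 : ℝ) ^ n /
    (π ^ ((1 : ℝ) / 4) * 2 ^ ((n : ℝ) / 2) * √(Nat.factorial n)))).mul hiter
  refine h.congr_deriv ?_
  have hpow : (2 : ℝ) ^ (((n + 1 : ℕ) : ℝ) / 2) = 2 ^ ((n : ℝ) / 2) * √2 := by
    rw [sqrt_eq_rpow, ← rpow_add two_pos]
    push_cast
    ring_nf
  have hfact : √((Nat.factorial (n + 1) : ℕ) : ℝ) = √((n : ℝ) + 1) * √(Nat.factorial n) := by
    rw [← sqrt_mul (by positivity), Nat.factorial_succ]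
    push_cast
    rfl
  have hfact_pos : 0 < √(Nat.factorial n : ℝ) := sqrt_pos.2 (by positivity)
  have hsucc_pos : 0 < √((n : ℝ) + 1) := sqrt_pos.2 (by positivity)
  unfold normalizedHermiteFun
  rw [hpow, hfact, sqrt_mul zero_le_two, pow_succ]
  field_simp
  ring

/-- If all Hermite functions are bounded by `C`, their derivatives are bounded by
`C * (|x| + √(2 * (n + 1)))`. -/
theorem abs_mul_sub_normalizedHermiteFun_le {C : ℝ}
    (hb : ∀ (n : ℕ) (x : ℝ), |normalizedHermiteFun n x| ≤ C) (n : ℕ) (x : ℝ) :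
    |x * normalizedHermiteFun n x - √(2 * ((n : ℝ) + 1)) * normalizedHermiteFun (n + 1) x| ≤
      C * (|x| + √(2 * ((n : ℝ) + 1))) := by
  refine (abs_sub _ _).trans ?_
  rw [abs_mul, abs_mul, abs_of_nonneg (Real.sqrt_nonneg _), mul_comm C, add_mul]
  gcongr
  exacts [hb n x, hb (n + 1) x]

/-- The mean of `f` over `[a, a + h]` differs from `f a` by at most `K * |h|` if the derivative of
`f` is bounded by `K` there. -/
theorem abs_average_sub_le_of_hasDerivAt {f f' : ℝ → ℝ} {a h K : ℝ} (hh : h ≠ 0)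
    (hf : ∀ x, HasDerivAt f (f' x) x) (hK : ∀ x, |x - a| ≤ |h| → |f' x| ≤ K) :
    |(1 / h) * (∫ u in a..(a + h), f u) - f a| ≤ K * |h| := by
  have hcont : Continuous f := continuous_iff_continuousAt.2 fun x => (hf x).continuousAt
  have hlip : ∀ u, |u - a| ≤ |h| → |f u - f a| ≤ K * |h| := by
    intro u hu
    have hK0 : 0 ≤ K := (abs_nonneg _).trans (hK u hu)
    have := (convex_closedBall a |h|).norm_image_sub_le_of_norm_hasDerivWithin_le
      (fun x _ => (hf x).hasDerivWithinAt) (fun x hx => hK x (by simpa [Real.dist_eq] using hx))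
      (Metric.mem_closedBall_self (abs_nonneg h))
      (show u ∈ Metric.closedBall a |h| by simpa [Real.dist_eq] using hu)
    exact this.trans (mul_le_mul_of_nonneg_left hu hK0)
  have hint : ‖∫ u in a..(a + h), (f u - f a)‖ ≤ K * |h| * |a + h - a| := by
    refine intervalIntegral.norm_integral_le_of_norm_le_const fun u hu => hlip u ?_
    simpa using Set.abs_sub_left_of_mem_uIcc (Set.uIoc_subset_uIcc hu)
  have heq : (1 / h) * (∫ u in a..(a + h), f u) - f a =
      (1 / h) * ∫ u in a..(a + h), (f u - f a) := by
    rw [intervalIntegral.integral_sub (hcont.intervalIntegrable _ _) (by simp),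
      intervalIntegral.integral_const, smul_eq_mul]
    field_simp
    ring
  have hpos : 0 < |h| := abs_pos.2 hh
  rw [heq, abs_mul, abs_div, abs_one, one_div, inv_mul_le_iff₀ hpos]
  simpa [mul_comm] using hint

theorem summable_kondratiev_weight_mul_sq (C : ℝ) {a : ℝ} :
    Summable (fun n : ℕ => (1 / (8 * ((n : ℝ) + 1) ^ 3)) * C ^ 2 *
      (a + √(2 * ((n : ℝ) + 1))) ^ 2) := by
  have hsum : Summable (fun n : ℕ => C ^ 2 * (2 * a ^ 2 + 4) / 8 * (1 / ((n : ℝ) + 1) ^ 2)) := by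
    refine Summable.mul_left _ ?_
    exact_mod_cast (summable_nat_add_iff 1).2 (Real.summable_one_div_nat_pow.2 one_lt_two)
  refine hsum.of_nonneg_of_le (fun n => by positivity) fun n => ?_
  have hsq : √(2 * ((n : ℝ) + 1)) ^ 2 = 2 * ((n : ℝ) + 1) := Real.sq_sqrt (by positivity)
  have hle : (a + √(2 * ((n : ℝ) + 1))) ^ 2 ≤ (2 * a ^ 2 + 4) * ((n : ℝ) + 1) := by
    nlinarith [sq_nonneg (a - √(2 * ((n : ℝ) + 1))), mul_nonneg (sq_nonneg a) n.cast_nonneg (α := ℝ)]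
  calc _ ≤ (1 / (8 * ((n : ℝ) + 1) ^ 3)) * C ^ 2 * ((2 * a ^ 2 + 4) * ((n : ℝ) + 1)) := by gcongr
    _ = _ := by field_simp

theorem brownian_difference_quotient_to_white_noise (C : ℝ) (hC : 0 < C)
    (hb : ∀ (n : ℕ) (x : ℝ), |normalizedHermiteFun n x| ≤ C) (lam : ℝ) :
    Filter.Tendsto
      (fun h : ℝ => ∑' n : ℕ,
        (1 / (8 * ((n : ℝ) + 1) ^ 3)) *
          ((1 / h) * (∫ u in lam..(lam + h), normalizedHermiteFun n u) -
            normalizedHermiteFun n lam) ^ 2)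
      (nhdsWithin 0 {(0 : ℝ)}ᶜ) (nhds 0) ∧
    (∀ h : ℝ, 0 < |h| → |h| ≤ 1 →
      ∑' n : ℕ, (1 / (8 * ((n : ℝ) + 1) ^ 3)) *
          ((1 / h) * (∫ u in lam..(lam + h), normalizedHermiteFun n u) -
            normalizedHermiteFun n lam) ^ 2
        ≤ h ^ 2 * ∑' n : ℕ, (1 / (8 * ((n : ℝ) + 1) ^ 3)) * C ^ 2 *
            (|lam| + 1 + Real.sqrt (2 * ((n : ℝ) + 1))) ^ 2) ∧
    Summable (fun n : ℕ => (1 / (8 * ((n : ℝ) + 1) ^ 3)) * C ^ 2 *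
        (|lam| + 1 + Real.sqrt (2 * ((n : ℝ) + 1))) ^ 2) := by
  have hsum := summable_kondratiev_weight_mul_sq C (a := |lam| + 1)
  have hterm : ∀ h : ℝ, 0 < |h| → |h| ≤ 1 → ∀ n : ℕ,
      (1 / (8 * ((n : ℝ) + 1) ^ 3)) *
          ((1 / h) * (∫ u in lam..(lam + h), normalizedHermiteFun n u) -
            normalizedHermiteFun n lam) ^ 2 ≤
        h ^ 2 * ((1 / (8 * ((n : ℝ) + 1) ^ 3)) * C ^ 2 *
          (|lam| + 1 + Real.sqrt (2 * ((n : ℝ) + 1))) ^ 2) := by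
    intro h h0 h1 n
    have havg := abs_average_sub_le_of_hasDerivAt (a := lam)
      (K := C * (|lam| + 1 + √(2 * ((n : ℝ) + 1)))) (abs_pos.1 h0)
      (hasDerivAt_normalizedHermiteFun n) fun x hx => by
        refine (abs_mul_sub_normalizedHermiteFun_le hb n x).trans ?_
        have := abs_sub_abs_le_abs_sub x lam
        gcongr
        linarith
    have hsq := pow_le_pow_left₀ (abs_nonneg _) havg 2
    rw [sq_abs, mul_pow, sq_abs] at hsq
    refine (mul_le_mul_of_nonneg_left hsq (by positivity)).trans_eq ?_
    ring
  have hbound : ∀ h : ℝ, 0 < |h| → |h| ≤ 1 →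
      ∑' n : ℕ, (1 / (8 * ((n : ℝ) + 1) ^ 3)) *
          ((1 / h) * (∫ u in lam..(lam + h), normalizedHermiteFun n u) -
            normalizedHermiteFun n lam) ^ 2
        ≤ h ^ 2 * ∑' n : ℕ, (1 / (8 * ((n : ℝ) + 1) ^ 3)) * C ^ 2 *
            (|lam| + 1 + Real.sqrt (2 * ((n : ℝ) + 1))) ^ 2 := by
    intro h h0 h1
    rw [← tsum_mul_left]
    exact ((hsum.mul_left _).of_nonneg_of_le (fun n => by positivity) (hterm h h0 h1)).tsum_le_tsum
      (hterm h h0 h1) (hsum.mul_left _)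
  refine ⟨?_, hbound, hsum⟩
  have hzero : Filter.Tendsto (fun h : ℝ => h ^ 2 * ∑' n : ℕ, (1 / (8 * ((n : ℝ) + 1) ^ 3)) * C ^ 2 *
      (|lam| + 1 + Real.sqrt (2 * ((n : ℝ) + 1))) ^ 2) (nhdsWithin 0 {(0 : ℝ)}ᶜ) (nhds 0) := by
    refine Filter.Tendsto.mono_left ?_ nhdsWithin_le_nhds
    exact Continuous.tendsto' (by fun_prop) _ _ (by simp)
  refine squeeze_zero' (Filter.Eventually.of_forall fun h => tsum_nonneg fun n => by positivity)
    ?_ hzero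
  filter_upwards [self_mem_nhdsWithin,
    nhdsWithin_le_nhds (Metric.closedBall_mem_nhds (0 : ℝ) one_pos)] with h h0 h1
  exact hbound h (abs_pos.2 h0) (by simpa using h1)
end
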